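/- Let V₀, V₁, V₂, V₃, T be real vector spaces, let d₀ : V₀ → V₁, d₁ : V₁ → V₂, d₂ : V₂ → V₃, G : V₂ → T be linear maps with d₁ ∘ d₀ = 0 and d₂ ∘ d₁ = 0, let c be a nonzero real number, and set L := c • (G ∘ d₁). Assume the four spaces H := ker d₁ ⧸ range d₀, H_L := ker L ⧸ range d₀, ℋ := ker G ⊓ ker d₂, and H' := ker d₂ ⧸ range d₁ are finite-dimensional. Then dim H + dim ℋ ≤ dim H' + dim H_L. -/

import Mathlib

/-- If `f` is injective, `g ∘ f = 0` and `ker h ≤ range g`, then in `A → B → C → D` the dimensions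
satisfy `dim A + dim C ≤ dim D + dim B`. -/
theorem finrank_add_finrank_le_of_exact {K A B C D : Type*} [DivisionRing K]
    [AddCommGroup A] [Module K A] [AddCommGroup B] [Module K B]
    [AddCommGroup C] [Module K C] [AddCommGroup D] [Module K D]
    [FiniteDimensional K B] [FiniteDimensional K C] [FiniteDimensional K D]
    (f : A →ₗ[K] B) (g : B →ₗ[K] C) (h : C →ₗ[K] D) (hf : Function.Injective f)
    (hfg : LinearMap.range f ≤ LinearMap.ker g) (hgh : LinearMap.ker h ≤ LinearMap.range g) :
    Module.finrank K A + Module.finrank K C ≤ Module.finrank K D + Module.finrank K B := by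
  have hA := LinearMap.finrank_range_of_inj hf
  have hfg' := Submodule.finrank_mono hfg
  have hgh' := Submodule.finrank_mono hgh
  have hD := Submodule.finrank_le (LinearMap.range h)
  have hg := g.finrank_range_add_finrank_ker
  have hh := h.finrank_range_add_finrank_ker
  lia

/-- Dimension estimate of Proposition 2.5 of Branson–Gover:
`dim H^{k-1}(M) + dim ℋ^k ≤ dim H^k(M) + dim H^{k-1}_L(M)`. -/
theorem stmt_4
    {V₀ V₁ V₂ V₃ T : Type*}
    [AddCommGroup V₀] [Module ℝ V₀] [AddCommGroup V₁] [Module ℝ V₁]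
    [AddCommGroup V₂] [Module ℝ V₂] [AddCommGroup V₃] [Module ℝ V₃]
    [AddCommGroup T] [Module ℝ T]
    (d₀ : V₀ →ₗ[ℝ] V₁) (d₁ : V₁ →ₗ[ℝ] V₂) (d₂ : V₂ →ₗ[ℝ] V₃)
    (G : V₂ →ₗ[ℝ] T)
    (h₁₀ : d₁ ∘ₗ d₀ = 0) (h₂₁ : d₂ ∘ₗ d₁ = 0)
    (c : ℝ) (hc : c ≠ 0)
    (L : V₁ →ₗ[ℝ] T) (hL : L = c • (G ∘ₗ d₁))
    [FiniteDimensional ℝ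
      (↥(LinearMap.ker d₁) ⧸ (LinearMap.range d₀).comap (LinearMap.ker d₁).subtype)]
    [FiniteDimensional ℝ
      (↥(LinearMap.ker L) ⧸ (LinearMap.range d₀).comap (LinearMap.ker L).subtype)]
    [FiniteDimensional ℝ ↥(LinearMap.ker G ⊓ LinearMap.ker d₂)]
    [FiniteDimensional ℝ
      (↥(LinearMap.ker d₂) ⧸ (LinearMap.range d₁).comap (LinearMap.ker d₂).subtype)] :
    Module.finrank ℝ
        (↥(LinearMap.ker d₁) ⧸ (LinearMap.range d₀).comap (LinearMap.ker d₁).subtype) +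
      Module.finrank ℝ ↥(LinearMap.ker G ⊓ LinearMap.ker d₂) ≤
    Module.finrank ℝ
        (↥(LinearMap.ker d₂) ⧸ (LinearMap.range d₁).comap (LinearMap.ker d₂).subtype) +
      Module.finrank ℝ
        (↥(LinearMap.ker L) ⧸ (LinearMap.range d₀).comap (LinearMap.ker L).subtype) := by
  have mem_ker_L (x : V₁) : x ∈ LinearMap.ker L ↔ G (d₁ x) = 0 := by
    simp [hL, hc]
  have d₁_d₀ (x : V₀) : d₁ (d₀ x) = 0 := LinearMap.congr_fun h₁₀ x
  have d₂_d₁ (x : V₁) : d₂ (d₁ x) = 0 := LinearMap.congr_fun h₂₁ x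
  have ker_le : LinearMap.ker d₁ ≤ LinearMap.ker L := fun x hx => by
    rw [mem_ker_L, LinearMap.mem_ker.1 hx, map_zero]
  let f := Submodule.mapQ ((LinearMap.range d₀).comap (LinearMap.ker d₁).subtype)
    ((LinearMap.range d₀).comap (LinearMap.ker L).subtype) (Submodule.inclusion ker_le)
    (fun _ hx => hx)
  let g := ((LinearMap.range d₀).comap (LinearMap.ker L).subtype).liftQ
    ((d₁ ∘ₗ (LinearMap.ker L).subtype).codRestrict (LinearMap.ker G ⊓ LinearMap.ker d₂)
      (fun x => ⟨(mem_ker_L x).1 x.2, d₂_d₁ x⟩))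
    (by
      rintro x ⟨y, hy⟩
      refine LinearMap.mem_ker.2 (Subtype.ext ?_)
      change d₁ x = 0
      change d₀ y = x at hy
      rw [← hy, d₁_d₀])
  let h := ((LinearMap.range d₁).comap (LinearMap.ker d₂).subtype).mkQ ∘ₗ
    Submodule.inclusion (inf_le_right : LinearMap.ker G ⊓ LinearMap.ker d₂ ≤ LinearMap.ker d₂)
  refine finrank_add_finrank_le_of_exact f g h ?_ ?_ ?_
  · rw [← LinearMap.ker_eq_bot, eq_bot_iff]
    intro q hq
    obtain ⟨x, rfl⟩ := Submodule.mkQ_surjective _ q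
    have hx : Submodule.inclusion ker_le x ∈
        (LinearMap.range d₀).comap (LinearMap.ker L).subtype :=
      (Submodule.Quotient.mk_eq_zero _).1 hq
    exact (Submodule.Quotient.mk_eq_zero _).2 hx
  · rintro _ ⟨q, rfl⟩
    obtain ⟨x, rfl⟩ := Submodule.mkQ_surjective _ q
    exact LinearMap.mem_ker.2 (Subtype.ext x.2)
  · intro y hy
    obtain ⟨x, hx⟩ := (Submodule.Quotient.mk_eq_zero _).1 hy
    change d₁ x = y at hx
    exact ⟨Submodule.Quotient.mk ⟨x, (mem_ker_L x).2 (hx ▸ y.2.1)⟩, Subtype.ext hx⟩
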